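/- Let 1 ≤ a < b, A ∈ ℝ, B ≥ 0, and let h ∈ C¹([a,b]) be complex valued. Then for all t > 0, |∫_a^b e^{itλ²} e^{iρ₊(λ)A} e^{iλB} h(λ) dλ| ≤ 30 (sup_{[a,b]}|h| + ∫_a^b |h'(λ)| dλ) t^{−1/2}. -/

import Mathlib

open MeasureTheory Complex

/-- The function `ρ₊(λ)`: `(λ²−1)^{1/2}` for `λ > 1`, `i(1−λ²)^{1/2}` for `−1 ≤ λ ≤ 1`,
`−(λ²−1)^{1/2}` for `λ < −1`. -/
noncomputable def rhoPlus (l : ℝ) : ℂ :=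
  if 1 < l then (Real.sqrt (l ^ 2 - 1) : ℂ)
  else if l < -1 then -(Real.sqrt (l ^ 2 - 1) : ℂ)
  else Complex.I * (Real.sqrt (1 - l ^ 2) : ℂ)

/-- Nonstationary phase estimate: if the phase `ψ` is convex with `|ψ'| ≥ m`, one integration by
parts bounds the oscillatory integral with amplitude `g`. -/
theorem norm_integral_exp_mul_le_of_le_abs_deriv {p q m G : ℝ} (hpq : p ≤ q) (hm : 0 < m)
    {ψ ψ₁ ψ₂ : ℝ → ℝ} {g g' : ℝ → ℂ}
    (hψ : ∀ x, HasDerivAt ψ (ψ₁ x) x) (hψ₁ : ∀ x, HasDerivAt ψ₁ (ψ₂ x) x)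
    (hψ₂ : Continuous ψ₂) (hψ₂_nonneg : ∀ x, 0 ≤ ψ₂ x)
    (hle : ∀ x ∈ Set.Icc p q, m ≤ |ψ₁ x|)
    (hg : ∀ x ∈ Set.Icc p q, HasDerivWithinAt g (g' x) (Set.Icc p q) x)
    (hg' : ContinuousOn g' (Set.Icc p q)) (hG : ∀ x ∈ Set.Icc p q, ‖g x‖ ≤ G) :
    ‖∫ x in p..q, exp (I * (ψ x : ℂ)) * g x‖ ≤ (4 * G + ∫ x in p..q, ‖g' x‖) / m := by
  have hψc : Continuous ψ := continuous_iff_continuousAt.2 fun x => (hψ x).continuousAt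
  have hψ₁c : Continuous ψ₁ := continuous_iff_continuousAt.2 fun x => (hψ₁ x).continuousAt
  have hgc : ContinuousOn g (Set.Icc p q) := fun x hx => (hg x hx).continuousWithinAt
  have hne : ∀ x ∈ Set.Icc p q, ψ₁ x ≠ 0 := fun x hx h0 => by
    have := hle x hx
    rw [h0, abs_zero] at this
    linarith
  have hneC : ∀ x ∈ Set.Icc p q, I * (ψ₁ x : ℂ) ≠ 0 := fun x hx =>
    mul_ne_zero I_ne_zero (ofReal_ne_zero.2 (hne x hx))
  have hG0 : 0 ≤ G := (norm_nonneg _).trans (hG p ⟨le_rfl, hpq⟩)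
  have hp : p ∈ Set.Icc p q := ⟨le_rfl, hpq⟩
  have hq : q ∈ Set.Icc p q := ⟨hpq, le_rfl⟩
  have hinv : ∀ x ∈ Set.Icc p q, |(ψ₁ x)⁻¹| ≤ m⁻¹ := fun x hx => by
    rw [abs_inv]
    exact inv_anti₀ hm (hle x hx)
  set F : ℝ → ℂ := fun x => exp (I * (ψ x : ℂ)) * (g x * (I * (ψ₁ x : ℂ))⁻¹) with hF
  set R : ℝ → ℂ := fun x => exp (I * (ψ x : ℂ)) *
    (g' x * (I * (ψ₁ x : ℂ))⁻¹ + g x * (-(I * (ψ₂ x : ℂ)) / (I * (ψ₁ x : ℂ)) ^ 2)) with hR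
  have hFnorm : ∀ x ∈ Set.Icc p q, ‖F x‖ ≤ G / m := fun x hx => by
    have h1 := hinv x hx
    rw [abs_inv] at h1
    simp only [hF, norm_mul, norm_inv, norm_exp_I_mul_ofReal, norm_I, norm_real,
      Real.norm_eq_abs, one_mul, div_eq_mul_inv]
    exact mul_le_mul (hG x hx) h1 (by positivity) hG0
  have hexpc : Continuous fun x => exp (I * (ψ x : ℂ)) := by fun_prop
  have hinvc : ContinuousOn (fun x => (I * (ψ₁ x : ℂ))⁻¹) (Set.Icc p q) :=
    ContinuousOn.inv₀ (by fun_prop) hneC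
  have hFc : ContinuousOn F (Set.Icc p q) := hexpc.continuousOn.mul (hgc.mul hinvc)
  have hRc : ContinuousOn R (Set.Icc p q) :=
    hexpc.continuousOn.mul ((hg'.mul hinvc).add (hgc.mul (ContinuousOn.div (by fun_prop)
      (by fun_prop) fun x hx => pow_ne_zero 2 (hneC x hx))))
  have hEc : ContinuousOn (fun x => exp (I * (ψ x : ℂ)) * g x) (Set.Icc p q) :=
    hexpc.continuousOn.mul hgc
  have hFd : ∀ x ∈ Set.Ioo p q, HasDerivAt F (exp (I * (ψ x : ℂ)) * g x + R x) x := by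
    intro x hx
    have hx' := Set.Ioo_subset_Icc_self hx
    have h1 := (((hψ x).ofReal_comp).const_mul I).cexp
    have h2 := (((hψ₁ x).ofReal_comp).const_mul I).inv (hneC x hx')
    have h3 := (hg x hx').hasDerivAt (Icc_mem_nhds hx.1 hx.2)
    refine (h1.mul (h3.mul h2)).congr_deriv ?_
    have := hneC x hx'
    simp only [hR, Pi.inv_apply, Pi.mul_apply]
    generalize I * (ψ₁ x : ℂ) = w at this ⊢
    field_simp
  have hint : (∫ x in p..q, exp (I * (ψ x : ℂ)) * g x) = F q - F p - ∫ x in p..q, R x := by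
    rw [← intervalIntegral.integral_eq_sub_of_hasDerivAt_of_le hpq hFc hFd
      ((hEc.add hRc).intervalIntegrable_of_Icc hpq),
      intervalIntegral.integral_add (hEc.intervalIntegrable_of_Icc hpq)
        (hRc.intervalIntegrable_of_Icc hpq)]
    ring
  have hinv2c : ContinuousOn (fun x => ψ₂ x / ψ₁ x ^ 2) (Set.Icc p q) :=
    ContinuousOn.div hψ₂.continuousOn (by fun_prop) fun x hx => pow_ne_zero 2 (hne x hx)
  have hvar : ∫ x in p..q, ψ₂ x / ψ₁ x ^ 2 ≤ 2 / m := by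
    have h1 : ∫ x in p..q, ψ₂ x / ψ₁ x ^ 2 = -(ψ₁ q)⁻¹ - -(ψ₁ p)⁻¹ := by
      refine intervalIntegral.integral_eq_sub_of_hasDerivAt_of_le (f := fun x => -(ψ₁ x)⁻¹) hpq
        (ContinuousOn.inv₀ hψ₁c.continuousOn hne).neg (fun x hx => ?_)
        (hinv2c.intervalIntegrable_of_Icc hpq)
      refine ((hψ₁ x).inv (hne x (Set.Ioo_subset_Icc_self hx))).neg.congr_deriv ?_
      ring
    have h2 := abs_le.1 (hinv q hq)
    have h3 := abs_le.1 (hinv p hp)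
    rw [h1, div_eq_mul_inv]
    linarith [h2.1, h3.2]
  have hRnorm : ‖∫ x in p..q, R x‖ ≤ (∫ x in p..q, ‖g' x‖) / m + G * (2 / m) := by
    calc ‖∫ x in p..q, R x‖
        ≤ ∫ x in p..q, (‖g' x‖ / m + G * (ψ₂ x / ψ₁ x ^ 2)) := by
          refine intervalIntegral.norm_integral_le_of_norm_le hpq
            (Filter.Eventually.of_forall fun x hx => ?_)
            (((hg'.norm.div_const m).add (hinv2c.const_mul G)).intervalIntegrable_of_Icc hpq)
          have hx' := Set.Ioc_subset_Icc_self hx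
          have h1 := hinv x hx'
          rw [abs_inv] at h1
          have h4 : 0 ≤ ψ₂ x / ψ₁ x ^ 2 := div_nonneg (hψ₂_nonneg x) (sq_nonneg _)
          simp only [hR, norm_mul, norm_exp_I_mul_ofReal, one_mul]
          refine (norm_add_le _ _).trans (add_le_add ?_ ?_)
          · simp only [norm_mul, norm_inv, norm_I, norm_real, Real.norm_eq_abs, one_mul,
              div_eq_mul_inv]
            exact mul_le_mul_of_nonneg_left h1 (norm_nonneg _)
          · simp only [norm_mul, norm_div, norm_neg, norm_pow, norm_I, norm_real,
              Real.norm_eq_abs, one_mul, sq_abs, abs_of_nonneg (hψ₂_nonneg x)]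
            exact mul_le_mul_of_nonneg_right (hG x hx') h4
      _ = (∫ x in p..q, ‖g' x‖) / m + G * ∫ x in p..q, ψ₂ x / ψ₁ x ^ 2 := by
          rw [intervalIntegral.integral_add
            ((hg'.norm.div_const m).intervalIntegrable_of_Icc hpq)
            ((hinv2c.const_mul G).intervalIntegrable_of_Icc hpq),
            intervalIntegral.integral_div, intervalIntegral.integral_const_mul]
      _ ≤ _ := by gcongr
  rw [hint]
  calc ‖F q - F p - ∫ x in p..q, R x‖
      ≤ ‖F q‖ + ‖F p‖ + ‖∫ x in p..q, R x‖ :=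
        (norm_sub_le _ _).trans (add_le_add_left (norm_sub_le _ _) _)
    _ ≤ G / m + G / m + ((∫ x in p..q, ‖g' x‖) / m + G * (2 / m)) :=
        add_le_add (add_le_add (hFnorm q hq) (hFnorm p hp)) hRnorm
    _ = _ := by ring

/-- Van der Corput's second derivative estimate with amplitude. -/
theorem norm_integral_exp_mul_le_of_le_deriv2 {c d t G : ℝ} (hcd : c ≤ d) (ht : 0 < t)
    {ψ ψ₁ ψ₂ : ℝ → ℝ} {g g' : ℝ → ℂ}
    (hψ : ∀ x, HasDerivAt ψ (ψ₁ x) x) (hψ₁ : ∀ x, HasDerivAt ψ₁ (ψ₂ x) x)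
    (hψ₂ : Continuous ψ₂) (hle : ∀ x, 2 * t ≤ ψ₂ x)
    (hg : ∀ x ∈ Set.Icc c d, HasDerivWithinAt g (g' x) (Set.Icc c d) x)
    (hg' : ContinuousOn g' (Set.Icc c d)) (hG : ∀ x ∈ Set.Icc c d, ‖g x‖ ≤ G) :
    ‖∫ x in c..d, exp (I * (ψ x : ℂ)) * g x‖ ≤ (6 * G + ∫ x in c..d, ‖g' x‖) / √t := by
  have hψc : Continuous ψ := continuous_iff_continuousAt.2 fun x => (hψ x).continuousAt
  have hψ₁c : Continuous ψ₁ := continuous_iff_continuousAt.2 fun x => (hψ₁ x).continuousAt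
  have hgc : ContinuousOn g (Set.Icc c d) := fun x hx => (hg x hx).continuousWithinAt
  have hG0 : 0 ≤ G := (norm_nonneg _).trans (hG c ⟨le_rfl, hcd⟩)
  have hgrow : ∀ ⦃x y⦄, x ≤ y → 2 * t * (y - x) ≤ ψ₁ y - ψ₁ x :=
    mul_sub_le_image_sub_of_le_deriv (fun x => (hψ₁ x).differentiableAt)
      fun x => (hψ₁ x).deriv ▸ hle x
  obtain ⟨z, hz⟩ : ∃ z, ψ₁ z = 0 := by
    set r := |ψ₁ 0| / (2 * t) with hr
    have hr0 : 0 ≤ r := by positivity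
    have hrt : 2 * t * r = |ψ₁ 0| := by rw [hr]; field_simp
    have h1 := hgrow hr0
    have h2 := hgrow (neg_nonpos.2 hr0)
    have h3 := neg_abs_le (ψ₁ 0)
    have h4 := le_abs_self (ψ₁ 0)
    obtain ⟨z, -, hz⟩ := intermediate_value_Icc (a := -r) (b := r) (by linarith)
      hψ₁c.continuousOn (show (0 : ℝ) ∈ Set.Icc (ψ₁ (-r)) (ψ₁ r) from
        ⟨by linarith, by linarith⟩)
    exact ⟨z, hz⟩
  set s := √t with hs
  have hs0 : 0 < s := Real.sqrt_pos.2 ht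
  have hst : s * s = t := Real.mul_self_sqrt ht.le
  have hinvs : t * s⁻¹ = s := by rw [← hst]; field_simp
  set u := max c (min d (z - s⁻¹)) with hu
  set v := max c (min d (z + s⁻¹)) with hv
  have hsi : 0 < s⁻¹ := inv_pos.2 hs0
  have hcu : c ≤ u := le_max_left _ _
  have huv : u ≤ v := max_le_max le_rfl (min_le_min le_rfl (by linarith))
  have hvd : v ≤ d := max_le hcd (min_le_left _ _)
  have huv2 : v - u ≤ 2 * s⁻¹ := by
    rw [hu, hv]
    rcases max_cases c (min d (z - s⁻¹)) with h1 | h1 <;>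
    rcases max_cases c (min d (z + s⁻¹)) with h2 | h2 <;>
    rcases min_cases d (z - s⁻¹) with h3 | h3 <;>
    rcases min_cases d (z + s⁻¹) with h4 | h4 <;> linarith
  set E : ℝ → ℂ := fun x => exp (I * (ψ x : ℂ)) * g x with hE
  set V := ∫ x in c..d, ‖g' x‖ with hV
  have hEc : ContinuousOn E (Set.Icc c d) :=
    (show Continuous fun x => exp (I * (ψ x : ℂ)) by fun_prop).continuousOn.mul hgc
  have hsub : ∀ {p q}, c ≤ p → q ≤ d → Set.Icc p q ⊆ Set.Icc c d := fun h1 h2 =>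
    Set.Icc_subset_Icc h1 h2
  have hEi : ∀ {p q}, c ≤ p → p ≤ q → q ≤ d → IntervalIntegrable E volume p q :=
    fun h1 h2 h3 => (hEc.mono (hsub h1 h3)).intervalIntegrable_of_Icc h2
  have hg'i : ∀ {p q}, c ≤ p → p ≤ q → q ≤ d →
      IntervalIntegrable (fun x => ‖g' x‖) volume p q :=
    fun h1 h2 h3 => (hg'.norm.mono (hsub h1 h3)).intervalIntegrable_of_Icc h2
  have houter : ∀ {p q}, c ≤ p → p ≤ q → q ≤ d →
      (p < q → ∀ x ∈ Set.Icc p q, 2 * s ≤ |ψ₁ x|) →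
      ‖∫ x in p..q, E x‖ ≤ (4 * G + ∫ x in p..q, ‖g' x‖) / (2 * s) := by
    intro p q h1 h2 h3 h4
    rcases h2.eq_or_lt with rfl | h2'
    · simp only [intervalIntegral.integral_same, norm_zero]
      positivity
    · exact norm_integral_exp_mul_le_of_le_abs_deriv h2 (by positivity) hψ hψ₁ hψ₂
        (fun x => (by positivity : (0 : ℝ) ≤ 2 * t).trans (hle x)) (h4 h2')
        (fun x hx => (hg x (hsub h1 h3 hx)).mono (hsub h1 h3)) (hg'.mono (hsub h1 h3))
        (fun x hx => hG x (hsub h1 h3 hx))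
  have hleft := houter le_rfl hcu (huv.trans hvd) fun hlt x hx => by
    have h1 : u ≤ z - s⁻¹ := by
      rcases max_cases c (min d (z - s⁻¹)) with h1 | h1
      · linarith
      · exact (hu.trans h1.1).le.trans (min_le_right _ _)
    have h2 := hgrow (show x ≤ z by linarith [hx.2])
    have h3 : 2 * t * s⁻¹ ≤ 2 * t * (z - x) :=
      mul_le_mul_of_nonneg_left (by linarith [hx.2]) (by positivity)
    linarith [neg_le_abs (ψ₁ x)]
  have hright := houter (hcu.trans huv) hvd le_rfl fun hlt x hx => by
    have h1 : z + s⁻¹ ≤ v := by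
      rcases min_cases d (z + s⁻¹) with h1 | h1
      · exact absurd (h1.1.symm.le.trans (le_max_right _ _)) (not_le.2 hlt)
      · exact h1.1.symm.le.trans (le_max_right _ _)
    have h2 := hgrow (show z ≤ x by linarith [hx.1])
    have h3 : 2 * t * s⁻¹ ≤ 2 * t * (x - z) :=
      mul_le_mul_of_nonneg_left (by linarith [hx.1]) (by positivity)
    linarith [le_abs_self (ψ₁ x)]
  have hmid : ‖∫ x in u..v, E x‖ ≤ G * (2 * s⁻¹) := by
    have h1 : ‖∫ x in u..v, E x‖ ≤ G * |v - u| := by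
      refine intervalIntegral.norm_integral_le_of_norm_le_const fun x hx => ?_
      rw [Set.uIoc_of_le huv] at hx
      rw [hE, norm_mul, norm_exp_I_mul_ofReal, one_mul]
      exact hG x (hsub hcu hvd (Set.Ioc_subset_Icc_self hx))
    rw [abs_of_nonneg (sub_nonneg.2 huv)] at h1
    exact h1.trans (mul_le_mul_of_nonneg_left huv2 hG0)
  have hsplit : (∫ x in c..d, E x) =
      (∫ x in c..u, E x) + (∫ x in u..v, E x) + ∫ x in v..d, E x := by
    rw [intervalIntegral.integral_add_adjacent_intervals (hEi le_rfl hcu (huv.trans hvd))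
      (hEi hcu huv hvd), intervalIntegral.integral_add_adjacent_intervals
      (hEi le_rfl (hcu.trans huv) hvd) (hEi (hcu.trans huv) hvd le_rfl)]
  have hmono : ∀ {p q}, c ≤ p → p ≤ q → q ≤ d → ∫ x in p..q, ‖g' x‖ ≤ V :=
    fun h1 h2 h3 => intervalIntegral.integral_mono_interval h1 h2 h3
      (Filter.Eventually.of_forall fun _ => norm_nonneg _) (hg'i le_rfl hcd le_rfl)
  have hV1 := hmono le_rfl hcu (huv.trans hvd)
  have hV2 := hmono (hcu.trans huv) hvd le_rfl
  rw [hsplit]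
  calc _ ≤ _ := norm_add₃_le
    _ ≤ (4 * G + V) / (2 * s) + G * (2 * s⁻¹) + (4 * G + V) / (2 * s) := by
        refine add_le_add (add_le_add (hleft.trans ?_) hmid) (hright.trans ?_) <;> gcongr
    _ = _ := by field_simp; ring

theorem hasDerivAt_sqrt_one_add_sq (x : ℝ) :
    HasDerivAt (fun x : ℝ => √(1 + x ^ 2)) (x / √(1 + x ^ 2)) x := by
  have hpos : 0 < 1 + x ^ 2 := by positivity
  refine (((hasDerivAt_pow 2 x).const_add 1).sqrt hpos.ne').congr_deriv ?_
  have := (Real.sqrt_pos.2 hpos).ne'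
  field_simp
  norm_num

theorem hasDerivAt_div_sqrt_one_add_sq (x : ℝ) :
    HasDerivAt (fun x : ℝ => x / √(1 + x ^ 2)) (1 / √(1 + x ^ 2) ^ 3) x := by
  have hpos : 0 < √(1 + x ^ 2) := Real.sqrt_pos.2 (by positivity)
  have hsq : √(1 + x ^ 2) ^ 2 = 1 + x ^ 2 := Real.sq_sqrt (by positivity)
  refine ((hasDerivAt_id x).div (hasDerivAt_sqrt_one_add_sq x) hpos.ne').congr_deriv ?_
  simp only [id]
  field_simp
  linarith

theorem rhoPlus_of_one_le {l : ℝ} (hl : 1 ≤ l) : rhoPlus l = (√(l ^ 2 - 1) : ℂ) := by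
  rcases hl.eq_or_lt with rfl | hl
  · norm_num [rhoPlus]
  · rw [rhoPlus, if_pos hl]

/-- Van der Corput type estimate:
`|∫_a^b e^{itλ²} e^{iρ₊(λ)A} e^{iλB} h(λ) dλ| ≤ 30 (sup|h| + ∫|h'|) t^{−1/2}`. -/
theorem stmt10 (a b A B t : ℝ) (ha : 1 ≤ a) (hab : a < b) (hB : 0 ≤ B) (ht : 0 < t)
    (h h' : ℝ → ℂ)
    (hderiv : ∀ l ∈ Set.Icc a b, HasDerivWithinAt h (h' l) (Set.Icc a b) l)
    (hcont : ContinuousOn h' (Set.Icc a b)) :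
    ‖∫ l in Set.Icc a b,
        Complex.exp (Complex.I * (t : ℂ) * (l : ℂ) ^ 2)
          * Complex.exp (Complex.I * rhoPlus l * (A : ℂ))
          * Complex.exp (Complex.I * (l : ℂ) * (B : ℂ)) * h l‖
      ≤ 30 * ((⨆ l : Set.Icc a b, ‖h l‖) + ∫ l in Set.Icc a b, ‖h' l‖) * t ^ (-(1:ℝ)/2) := by
  set c := √(a ^ 2 - 1) with hc
  set d := √(b ^ 2 - 1) with hd
  set φ : ℝ → ℝ := fun x => √(1 + x ^ 2) with hφ
  have hb : 1 ≤ b := ha.trans hab.le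
  have hc0 : 0 ≤ c := Real.sqrt_nonneg _
  have hcd : c ≤ d := Real.sqrt_le_sqrt (by nlinarith)
  have hφc : φ c = a := by
    rw [hφ, hc]
    dsimp only
    rw [Real.sq_sqrt (by nlinarith), add_sub_cancel, Real.sqrt_sq (by linarith)]
  have hφd : φ d = b := by
    rw [hφ, hd]
    dsimp only
    rw [Real.sq_sqrt (by nlinarith), add_sub_cancel, Real.sqrt_sq (by linarith)]
  have hφpos : ∀ x, 0 < φ x := fun x => Real.sqrt_pos.2 (by positivity)
  have hφsq : ∀ x, φ x ^ 2 = 1 + x ^ 2 := fun x => Real.sq_sqrt (by positivity)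
  have hφcont : Continuous φ := by fun_prop
  have hφd1 : ∀ x, HasDerivAt φ (x / φ x) x := hasDerivAt_sqrt_one_add_sq
  have hφd2 : ∀ x, HasDerivAt (fun x => x / φ x) (1 / φ x ^ 3) x := hasDerivAt_div_sqrt_one_add_sq
  have hφd1c : Continuous fun x => x / φ x :=
    continuous_id.div hφcont fun x => (hφpos x).ne'
  have hφd2c : Continuous fun x => 1 / φ x ^ 3 :=
    continuous_const.div (hφcont.pow 3) fun x => (pow_pos (hφpos x) 3).ne'
  have hmaps : Set.MapsTo φ (Set.Icc c d) (Set.Icc a b) := fun x hx => by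
    have hx0 : 0 ≤ x := hc0.trans hx.1
    rw [← hφc, ← hφd]
    exact ⟨Real.sqrt_le_sqrt (by nlinarith [hx.1]), Real.sqrt_le_sqrt (by nlinarith [hx.2])⟩
  have himage : φ '' Set.uIcc c d ⊆ Set.Icc a b := by
    rw [Set.uIcc_of_le hcd]
    exact hmaps.image_subset
  have hhc : ContinuousOn h (Set.Icc a b) := fun x hx => (hderiv x hx).continuousWithinAt
  set H := ⨆ l : Set.Icc a b, ‖h l‖ with hH
  have hHle : ∀ l ∈ Set.Icc a b, ‖h l‖ ≤ H := fun l hl => by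
    have hbdd := (isCompact_Icc.image_of_continuousOn hhc.norm).bddAbove
    rw [Set.image_eq_range] at hbdd
    exact le_ciSup hbdd ⟨l, hl⟩
  have hH0 : 0 ≤ H := (norm_nonneg _).trans (hHle a ⟨le_rfl, hab.le⟩)
  set ψ : ℝ → ℝ := fun x => t * (1 + x ^ 2) + x * A + φ x * B with hψ
  set g : ℝ → ℂ := fun x => (x / φ x) • h (φ x) with hg
  set g' : ℝ → ℂ := fun x => (x / φ x) • ((x / φ x) • h' (φ x)) + (1 / φ x ^ 3) • h (φ x) with hg'
  have hψd1 : ∀ x, HasDerivAt ψ (2 * t * x + A + x / φ x * B) x := fun x => by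
    refine ((((((hasDerivAt_id x).pow 2).const_add 1).const_mul t).add
      ((hasDerivAt_id x).mul_const A)).add ((hφd1 x).mul_const B)).congr_deriv ?_
    simp only [id]
    ring
  have hψd2 : ∀ x, HasDerivAt (fun x => 2 * t * x + A + x / φ x * B)
      (2 * t + 1 / φ x ^ 3 * B) x := fun x => by
    refine ((((hasDerivAt_id x).const_mul (2 * t)).add_const A).add
      ((hφd2 x).mul_const B)).congr_deriv ?_
    ring
  have hgd : ∀ x ∈ Set.Icc c d, HasDerivWithinAt g (g' x) (Set.Icc c d) x := fun x hx =>
    (hφd2 x).hasDerivWithinAt.smul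
      ((hderiv (φ x) (hmaps hx)).scomp x (hφd1 x).hasDerivWithinAt hmaps)
  have hhφ : ContinuousOn (fun x => h (φ x)) (Set.Icc c d) :=
    hhc.comp hφcont.continuousOn hmaps
  have hh'φ : ContinuousOn (fun x => h' (φ x)) (Set.Icc c d) :=
    hcont.comp hφcont.continuousOn hmaps
  have hg'c : ContinuousOn g' (Set.Icc c d) :=
    (hφd1c.continuousOn.smul (hφd1c.continuousOn.smul hh'φ)).add (hφd2c.continuousOn.smul hhφ)
  have hratio0 : ∀ x, 0 ≤ x → 0 ≤ x / φ x := fun x hx => div_nonneg hx (hφpos x).le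
  have hratio1 : ∀ x, x / φ x ≤ 1 := fun x => by
    rw [div_le_one (hφpos x)]
    exact Real.le_sqrt_of_sq_le (by linarith)
  have hgH : ∀ x ∈ Set.Icc c d, ‖g x‖ ≤ H := fun x hx => by
    have hx0 := hratio0 x (hc0.trans hx.1)
    rw [hg, norm_smul, Real.norm_of_nonneg hx0]
    exact (mul_le_of_le_one_left (norm_nonneg _) (hratio1 x)).trans (hHle _ (hmaps hx))
  have hvdc := norm_integral_exp_mul_le_of_le_deriv2 hcd ht hψd1 hψd2
    (continuous_const.add (hφd2c.mul continuous_const))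
    (fun x => le_add_of_nonneg_right
      (mul_nonneg (one_div_nonneg.2 (pow_pos (hφpos x) 3).le) hB)) hgd hg'c hgH
  have hcov : ∫ x in c..d, (x / φ x) • ‖h' (φ x)‖ = ∫ l in a..b, ‖h' l‖ := by
    have := intervalIntegral.integral_deriv_smul_comp' (g := fun l => ‖h' l‖)
      (fun x _ => hφd1 x) hφd1c.continuousOn (hcont.norm.mono himage)
    rwa [hφc, hφd] at this
  have hW0 : 0 ≤ ∫ l in a..b, ‖h' l‖ :=
    intervalIntegral.integral_nonneg hab.le fun _ _ => norm_nonneg _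
  have hvar : ∫ x in c..d, ‖g' x‖ ≤ (∫ l in a..b, ‖h' l‖) + H := by
    have hi1 : IntervalIntegrable (fun x => (x / φ x) • ‖h' (φ x)‖) volume c d :=
      (hφd1c.continuousOn.smul hh'φ.norm).intervalIntegrable_of_Icc hcd
    have hi2 : IntervalIntegrable (fun x => 1 / φ x ^ 3) volume c d :=
      hφd2c.intervalIntegrable c d
    calc ∫ x in c..d, ‖g' x‖
        ≤ ∫ x in c..d, ((x / φ x) • ‖h' (φ x)‖ + 1 / φ x ^ 3 * H) := by
          refine intervalIntegral.integral_mono_on hcd (hg'c.norm.intervalIntegrable_of_Icc hcd)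
            (hi1.add (hi2.mul_const H)) fun x hx => ?_
          have hx0 := hratio0 x (hc0.trans hx.1)
          have hx3 : 0 ≤ 1 / φ x ^ 3 := one_div_nonneg.2 (pow_pos (hφpos x) 3).le
          refine (norm_add_le _ _).trans (add_le_add ?_ ?_)
          · rw [norm_smul, norm_smul, Real.norm_of_nonneg hx0, smul_eq_mul]
            exact mul_le_of_le_one_left (mul_nonneg hx0 (norm_nonneg _)) (hratio1 x)
          · rw [norm_smul, Real.norm_of_nonneg hx3]
            exact mul_le_mul_of_nonneg_left (hHle _ (hmaps hx)) hx3
      _ = (∫ l in a..b, ‖h' l‖) + (d / φ d - c / φ c) * H := by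
          rw [intervalIntegral.integral_add hi1 (hi2.mul_const H), hcov,
            intervalIntegral.integral_mul_const,
            intervalIntegral.integral_eq_sub_of_hasDerivAt (fun x _ => hφd2 x) hi2]
      _ ≤ _ := by
          have h1 := hratio0 c hc0
          have h2 := hratio1 d
          gcongr
          exact mul_le_of_le_one_left hH0 (by linarith)
  set f : ℝ → ℂ := fun l => exp (I * (t : ℂ) * (l : ℂ) ^ 2) *
    exp (I * (√(l ^ 2 - 1) : ℂ) * (A : ℂ)) * exp (I * (l : ℂ) * (B : ℂ)) * h l with hf
  have hfc : ContinuousOn f (Set.Icc a b) := ContinuousOn.mul (by fun_prop) hhc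
  have hint : (∫ l in Set.Icc a b, exp (I * (t : ℂ) * (l : ℂ) ^ 2) *
      exp (I * rhoPlus l * (A : ℂ)) * exp (I * (l : ℂ) * (B : ℂ)) * h l) =
      ∫ x in c..d, exp (I * (ψ x : ℂ)) * g x := by
    have hcomp := intervalIntegral.integral_deriv_smul_comp' (g := f)
      (fun x _ => hφd1 x) hφd1c.continuousOn (hfc.mono himage)
    rw [hφc, hφd] at hcomp
    rw [setIntegral_congr_fun measurableSet_Icc (g := f) fun l hl => by
        simp only [hf, rhoPlus_of_one_le (ha.trans hl.1)],
      integral_Icc_eq_integral_Ioc, ← intervalIntegral.integral_of_le hab.le, ← hcomp]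
    refine intervalIntegral.integral_congr fun x hx => ?_
    rw [Set.uIcc_of_le hcd] at hx
    have hsqrt : √(φ x ^ 2 - 1) = x := by
      rw [hφsq, add_sub_cancel_left, Real.sqrt_sq (hc0.trans hx.1)]
    have hsq : (φ x : ℂ) ^ 2 = 1 + (x : ℂ) ^ 2 := by exact_mod_cast hφsq x
    simp only [hf, hg, Function.comp_apply, hsqrt, hsq, mul_smul_comm, ← exp_add]
    congr 3
    simp only [hψ]
    push_cast
    ring
  have hrpow : t ^ (-(1 : ℝ) / 2) = (√t)⁻¹ := by
    rw [neg_div, Real.rpow_neg ht.le, Real.sqrt_eq_rpow]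
  rw [hint, integral_Icc_eq_integral_Ioc, ← intervalIntegral.integral_of_le hab.le, hrpow,
    ← div_eq_mul_inv]
  refine hvdc.trans ?_
  gcongr
  linarith
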